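/- arXiv:2601.18840 — 6 statements merged into one kernel-verified Lean document; each statement's English description precedes it below -/
import Mathlib

section
/- For every Q : S × A → ℝ and every Q* : S × A → ℝ with T Q* = Q*, one has ‖Q − Q*‖∞ ≤ (1/(1−γ))·‖T Q − Q‖∞ ≤ (1/(1−γ))·‖T Q − Q‖₂. -/
noncomputable def supNorm {S A : Type*} [Fintype S] [Fintype A] [Nonempty S] [Nonempty A]
    (Q : S × A → ℝ) : ℝ :=
  Finset.univ.sup' Finset.univ_nonempty fun p => |Q p|

noncomputable def l2Norm {S A : Type*} [Fintype S] [Fintype A] (Q : S × A → ℝ) : ℝ :=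
  Real.sqrt (∑ p : S × A, (Q p) ^ 2)

/-- The control Bellman operator `T`. -/
noncomputable def bellT {S A : Type*} [Fintype S] [Fintype A] [Nonempty A]
    (P : S → A → S → ℝ) (R : S → A → ℝ) (γ : ℝ) (Q : S × A → ℝ) : S × A → ℝ :=
  fun p => R p.1 p.2 + γ * ∑ s' : S, P p.1 p.2 s' *
    (Finset.univ.sup' Finset.univ_nonempty fun a' : A => Q (s', a'))

theorem abs_le_supNorm {S A : Type*} [Fintype S] [Fintype A] [Nonempty S] [Nonempty A]
    (Q : S × A → ℝ) (p : S × A) : |Q p| ≤ supNorm Q :=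
  Finset.le_sup' (fun p => |Q p|) (Finset.mem_univ p)

theorem supNorm_le {S A : Type*} [Fintype S] [Fintype A] [Nonempty S] [Nonempty A]
    {Q : S × A → ℝ} {c : ℝ} (h : ∀ p, |Q p| ≤ c) : supNorm Q ≤ c :=
  Finset.sup'_le _ _ fun p _ => h p

theorem supNorm_le_l2Norm {S A : Type*} [Fintype S] [Fintype A] [Nonempty S] [Nonempty A]
    (Q : S × A → ℝ) : supNorm Q ≤ l2Norm Q :=
  supNorm_le fun p => Real.abs_le_sqrt <|
    Finset.single_le_sum (f := fun p => Q p ^ 2) (fun _ _ => sq_nonneg _) (Finset.mem_univ p)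

theorem sup'_le_sup'_add {A : Type*} [Fintype A] [Nonempty A] {f g : A → ℝ} {c : ℝ} (h : ∀ a, f a ≤ g a + c) :
    Finset.univ.sup' Finset.univ_nonempty f ≤ Finset.univ.sup' Finset.univ_nonempty g + c :=
  Finset.sup'_le _ _ fun a _ =>
    (h a).trans (add_le_add_left (Finset.le_sup' g (Finset.mem_univ a)) c)

theorem bellT_le_bellT_add {S A : Type*} [Fintype S] [Fintype A] [Nonempty A]
    {P : S → A → S → ℝ} (R : S → A → ℝ) {γ : ℝ}
    (hP0 : ∀ s a s', 0 ≤ P s a s') (hP1 : ∀ s a, ∑ s' : S, P s a s' = 1) (hγ0 : 0 ≤ γ)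
    {Q Q' : S × A → ℝ} {c : ℝ} (h : ∀ p, Q p ≤ Q' p + c) (p : S × A) :
    bellT P R γ Q p ≤ bellT P R γ Q' p + γ * c := by
  unfold bellT
  rw [add_assoc, ← mul_add]
  gcongr
  calc _ ≤ ∑ s', P p.1 p.2 s' *
        ((Finset.univ.sup' Finset.univ_nonempty fun a' : A => Q' (s', a')) + c) :=
        Finset.sum_le_sum fun s' _ =>
          mul_le_mul_of_nonneg_left (sup'_le_sup'_add fun a => h (s', a)) (hP0 _ _ _)
    _ = _ := by simp_rw [mul_add, Finset.sum_add_distrib, ← Finset.sum_mul, hP1, one_mul]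

/-- The control Bellman operator is a `γ`-contraction in the sup norm. -/
theorem abs_bellT_sub_bellT_le {S A : Type*} [Fintype S] [Fintype A] [Nonempty S] [Nonempty A]
    {P : S → A → S → ℝ} (R : S → A → ℝ) {γ : ℝ}
    (hP0 : ∀ s a s', 0 ≤ P s a s') (hP1 : ∀ s a, ∑ s' : S, P s a s' = 1) (hγ0 : 0 ≤ γ)
    (Q Q' : S × A → ℝ) (p : S × A) :
    |bellT P R γ Q p - bellT P R γ Q' p| ≤ γ * supNorm fun p => Q p - Q' p := by
  have h (p : S × A) := abs_le.mp (abs_le_supNorm (fun p => Q p - Q' p) p)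
  rw [abs_sub_le_iff]
  constructor
  · have := bellT_le_bellT_add R hP0 hP1 hγ0 (Q := Q) (Q' := Q')
      (c := supNorm fun p => Q p - Q' p)
      (fun p => by linarith [(h p).2]) p
    linarith
  · have := bellT_le_bellT_add R hP0 hP1 hγ0 (Q := Q') (Q' := Q)
      (c := supNorm fun p => Q p - Q' p)
      (fun p => by linarith [(h p).1]) p
    linarith

theorem stmt3 {S A : Type*} [Fintype S] [Fintype A] [Nonempty S] [Nonempty A]
    (P : S → A → S → ℝ) (R : S → A → ℝ) (γ : ℝ)
    (hP0 : ∀ s a s', 0 ≤ P s a s') (hP1 : ∀ s a, ∑ s' : S, P s a s' = 1)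
    (hγ0 : 0 ≤ γ) (hγ1 : γ < 1)
    (Q Qstar : S × A → ℝ) (hfix : bellT P R γ Qstar = Qstar) :
    supNorm (fun p => Q p - Qstar p) ≤ (1 / (1 - γ)) * supNorm (fun p => bellT P R γ Q p - Q p)
      ∧ (1 / (1 - γ)) * supNorm (fun p => bellT P R γ Q p - Q p)
        ≤ (1 / (1 - γ)) * l2Norm (fun p => bellT P R γ Q p - Q p) := by
  have hγ : 0 < 1 - γ := sub_pos.mpr hγ1
  refine ⟨?_, mul_le_mul_of_nonneg_left (supNorm_le_l2Norm _) (by positivity)⟩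
  rw [one_div_mul_eq_div, le_div_iff₀ hγ]
  have key : supNorm (fun p => Q p - Qstar p) ≤ supNorm (fun p => bellT P R γ Q p - Q p)
      + γ * supNorm (fun p => Q p - Qstar p) := by
    refine supNorm_le fun p => ?_
    have hres := abs_le_supNorm (fun p => bellT P R γ Q p - Q p) p
    have hcontr := abs_bellT_sub_bellT_le R hP0 hP1 hγ0 Q Qstar p
    rw [hfix] at hcontr
    have htri := abs_sub_le (Q p) (bellT P R γ Q p) (Qstar p)
    rw [abs_sub_comm (Q p) (bellT P R γ Q p)] at htri
    linarith
  linarith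
end

section
/- Let Q* : S × A → ℝ satisfy T Q* = Q*, let n = (card S)·(card A), and let Φ be a feature matrix. Then for every θ : Fin m → ℝ, ((1−γ)²/(2n))·‖Q_θ − Q*‖₂² ≤ (1/2)·‖T Q_θ − Q_θ‖₂² ≤ ((1+γ)²·n/2)·‖Q_θ − Q*‖₂². -/
theorem abs_bellT_sub_le {S A : Type*} [Fintype S] [Fintype A] [Nonempty A]
    (P : S → A → S → ℝ) (R : S → A → ℝ) (γ : ℝ)
    (hP0 : ∀ s a s', 0 ≤ P s a s') (hP1 : ∀ s a, ∑ s' : S, P s a s' = 1)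
    (hγ0 : 0 ≤ γ) (Q Q' : S × A → ℝ) (c : ℝ) (h : ∀ p, |Q p - Q' p| ≤ c) (p : S × A) :
    |bellT P R γ Q p - bellT P R γ Q' p| ≤ γ * c := by
  have key : ∀ Q Q' : S × A → ℝ, (∀ p, |Q p - Q' p| ≤ c) →
      bellT P R γ Q p - bellT P R γ Q' p ≤ γ * c := by
    intro Q Q' h
    have hsup : ∀ s' : S, (Finset.univ.sup' Finset.univ_nonempty fun a' : A => Q (s', a')) ≤
        (Finset.univ.sup' Finset.univ_nonempty fun a' : A => Q' (s', a')) + c := by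
      intro s'
      refine Finset.sup'_le _ _ fun a _ => ?_
      have h1 := Finset.le_sup' (fun a' : A => Q' (s', a')) (Finset.mem_univ a)
      have h2 := (abs_le.mp (h (s', a))).2
      linarith
    have hsum := Finset.sum_le_sum fun s' (_ : s' ∈ Finset.univ) =>
      mul_le_mul_of_nonneg_left (hsup s') (hP0 p.1 p.2 s')
    simp only [mul_add, Finset.sum_add_distrib, ← Finset.sum_mul, hP1, one_mul] at hsum
    have := mul_le_mul_of_nonneg_left hsum hγ0
    unfold bellT
    linarith
  refine abs_le.mpr ⟨?_, key Q Q' h⟩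
  have := key Q' Q fun p => by rw [abs_sub_comm]; exact h p
  linarith

theorem l2Norm_sq {S A : Type*} [Fintype S] [Fintype A] (Q : S × A → ℝ) :
    l2Norm Q ^ 2 = ∑ p : S × A, Q p ^ 2 :=
  Real.sq_sqrt (Finset.sum_nonneg fun _ _ => sq_nonneg _)

theorem sq_mul_l2Norm_sq_le {S A : Type*} [Fintype S] [Fintype A] (f g : S × A → ℝ)
    (k l : ℝ) (hk : 0 ≤ k) (q : S × A) (h : ∀ p, k * |f p| ≤ l * |g q|) :
    k ^ 2 * l2Norm f ^ 2 ≤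
      l ^ 2 * ((Fintype.card S * Fintype.card A : ℕ) : ℝ) * l2Norm g ^ 2 := by
  have hq : g q ^ 2 ≤ l2Norm g ^ 2 := by
    rw [l2Norm_sq]
    exact Finset.single_le_sum (f := fun p => g p ^ 2) (fun _ _ => sq_nonneg _)
      (Finset.mem_univ q)
  have hp : ∀ p ∈ Finset.univ, k ^ 2 * f p ^ 2 ≤ l ^ 2 * l2Norm g ^ 2 := by
    intro p _
    have h1 := pow_le_pow_left₀ (mul_nonneg hk (abs_nonneg (f p))) (h p) 2
    rw [mul_pow, mul_pow, sq_abs, sq_abs] at h1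
    exact h1.trans (mul_le_mul_of_nonneg_left hq (sq_nonneg l))
  have hsum := Finset.sum_le_card_nsmul _ _ _ hp
  rw [← Finset.mul_sum, ← l2Norm_sq, nsmul_eq_mul, Finset.card_univ, Fintype.card_prod] at hsum
  linarith

theorem stmt5 {S A : Type*} [Fintype S] [Fintype A] [Nonempty S] [Nonempty A] {m : ℕ}
    (P : S → A → S → ℝ) (R : S → A → ℝ) (γ : ℝ)
    (hP0 : ∀ s a s', 0 ≤ P s a s') (hP1 : ∀ s a, ∑ s' : S, P s a s' = 1)
    (hγ0 : 0 ≤ γ) (hγ1 : γ < 1)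
    (Qstar : S × A → ℝ) (hfix : bellT P R γ Qstar = Qstar)
    (Φ : Matrix (S × A) (Fin m) ℝ) (θ : Fin m → ℝ) :
    ((1 - γ) ^ 2 / (2 * ((Fintype.card S * Fintype.card A : ℕ) : ℝ))) *
        (l2Norm (fun p => Φ.mulVec θ p - Qstar p)) ^ 2
      ≤ (1 / 2) * (l2Norm (fun p => bellT P R γ (Φ.mulVec θ) p - Φ.mulVec θ p)) ^ 2
    ∧ (1 / 2) * (l2Norm (fun p => bellT P R γ (Φ.mulVec θ) p - Φ.mulVec θ p)) ^ 2
      ≤ ((1 + γ) ^ 2 * ((Fintype.card S * Fintype.card A : ℕ) : ℝ) / 2) *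
        (l2Norm (fun p => Φ.mulVec θ p - Qstar p)) ^ 2 := by
  set Q := Φ.mulVec θ
  obtain ⟨q, hq⟩ := Finite.exists_max fun p => |Q p - Qstar p|
  have hT : ∀ p, |bellT P R γ Q p - Qstar p| ≤ γ * |Q q - Qstar q| := by
    intro p
    have h := abs_bellT_sub_le P R γ hP0 hP1 hγ0 Q Qstar _ hq p
    rwa [hfix] at h
  have hn : (0 : ℝ) < ((Fintype.card S * Fintype.card A : ℕ) : ℝ) :=
    Nat.cast_pos.mpr (Nat.mul_pos Fintype.card_pos Fintype.card_pos)
  constructor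
  · have h := sq_mul_l2Norm_sq_le (fun p => Q p - Qstar p) (fun p => bellT P R γ Q p - Q p)
      (1 - γ) 1 (by linarith) q fun p => by
        have h1 := abs_sub_le (Q q) (bellT P R γ Q q) (Qstar q)
        rw [abs_sub_comm (Q q) (bellT P R γ Q q)] at h1
        have h2 := mul_le_mul_of_nonneg_left (hq p) (by linarith : 0 ≤ 1 - γ)
        have h3 := hT q
        linarith
    rw [div_mul_eq_mul_div, div_le_iff₀ (by positivity)]
    linarith
  · have h := sq_mul_l2Norm_sq_le (fun p => bellT P R γ Q p - Q p) (fun p => Q p - Qstar p)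
      1 (1 + γ) zero_le_one q fun p => by
        have h1 := abs_sub_le (bellT P R γ Q p) (Qstar p) (Q p)
        rw [abs_sub_comm (Qstar p) (Q p)] at h1
        have h2 := hq p
        have h3 := hT p
        linarith
    linarith
end

section
/- Let Q : S × A → ℝ and suppose there exists a stochastic policy β : S → A → ℝ (β s a ≥ 0 and ∑_a β s a = 1 for every s) such that the vector (γ·M_β − I)ᵀ·(T Q − Q) is zero, where T Q − Q is viewed as a vector indexed by S × A. Then T Q = Q; consequently, for every Q* : S × A → ℝ with T Q* = Q*, one has Q = Q*. -/
/-- A vector fixed by `γ • Nᵀ`, with `N` row-stochastic and `0 ≤ γ < 1`, vanishes. -/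
theorem eq_zero_of_discounted_vecMul_eq {ι : Type*} [Fintype ι] {N : ι → ι → ℝ} {γ : ℝ}
    (hN0 : ∀ i j, 0 ≤ N i j) (hN1 : ∀ i, ∑ j, N i j = 1) (hγ0 : 0 ≤ γ) (hγ1 : γ < 1)
    {v : ι → ℝ} (hv : ∀ j, γ * ∑ i, N i j * v i = v j) : v = 0 := by
  have key : ∑ j, |v j| ≤ γ * ∑ i, |v i| := calc
    ∑ j, |v j| ≤ ∑ j, γ * ∑ i, N i j * |v i| := by
      refine Finset.sum_le_sum fun j _ => ?_
      rw [← hv j, abs_mul, abs_of_nonneg hγ0]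
      refine mul_le_mul_of_nonneg_left ((Finset.abs_sum_le_sum_abs _ _).trans_eq ?_) hγ0
      exact Finset.sum_congr rfl fun i _ => by rw [abs_mul, abs_of_nonneg (hN0 i j)]
    _ = γ * ∑ i, |v i| := by
      rw [← Finset.mul_sum, Finset.sum_comm]
      simp_rw [← Finset.sum_mul, hN1, one_mul]
  have hnn : 0 ≤ ∑ j, |v j| := Finset.sum_nonneg fun j _ => abs_nonneg _
  have hz : ∑ j, |v j| = 0 := by nlinarith
  ext j
  exact abs_eq_zero.mp
    ((Finset.sum_eq_zero_iff_of_nonneg fun i _ => abs_nonneg (v i)).mp hz j (Finset.mem_univ j))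

/-- One-sided `γ`-contraction estimate for the control Bellman operator. -/
theorem bellT_sub_le {S A : Type*} [Fintype S] [Fintype A] [Nonempty A]
    {P : S → A → S → ℝ} {R : S → A → ℝ} {γ : ℝ}
    (hP0 : ∀ s a s', 0 ≤ P s a s') (hP1 : ∀ s a, ∑ s' : S, P s a s' = 1) (hγ0 : 0 ≤ γ)
    {Q Q' : S × A → ℝ} {c : ℝ} (hc : ∀ p, Q p - Q' p ≤ c) (p : S × A) :
    bellT P R γ Q p - bellT P R γ Q' p ≤ γ * c := by
  have hsup : ∀ s, (Finset.univ.sup' Finset.univ_nonempty fun a : A => Q (s, a)) ≤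
      (Finset.univ.sup' Finset.univ_nonempty fun a : A => Q' (s, a)) + c := fun s =>
    Finset.sup'_le _ _ fun a _ => by
      have := Finset.le_sup' (fun a : A => Q' (s, a)) (Finset.mem_univ a)
      linarith [hc (s, a)]
  have hsum := Finset.sum_le_sum fun s (_ : s ∈ Finset.univ) =>
    mul_le_mul_of_nonneg_left (hsup s) (hP0 p.1 p.2 s)
  simp_rw [mul_add, Finset.sum_add_distrib, ← Finset.sum_mul, hP1, one_mul] at hsum
  have := mul_le_mul_of_nonneg_left hsum hγ0
  unfold bellT
  linarith

/-- The control Bellman operator has at most one fixed point. -/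
theorem bellT_fixedPoint_unique {S A : Type*} [Fintype S] [Fintype A] [Nonempty S] [Nonempty A]
    {P : S → A → S → ℝ} {R : S → A → ℝ} {γ : ℝ}
    (hP0 : ∀ s a s', 0 ≤ P s a s') (hP1 : ∀ s a, ∑ s' : S, P s a s' = 1)
    (hγ0 : 0 ≤ γ) (hγ1 : γ < 1) {Q Q' : S × A → ℝ}
    (hQ : bellT P R γ Q = Q) (hQ' : bellT P R γ Q' = Q') : Q = Q' := by
  have le_of_fixed : ∀ {Q Q' : S × A → ℝ}, bellT P R γ Q = Q → bellT P R γ Q' = Q' →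
      ∀ p, Q p ≤ Q' p := by
    intro Q Q' hQ hQ' p
    obtain ⟨m, hm⟩ := Finite.exists_max fun p => Q p - Q' p
    have h := bellT_sub_le (R := R) hP0 hP1 hγ0 hm m
    rw [hQ, hQ'] at h
    have := hm p
    nlinarith
  exact funext fun p => le_antisymm (le_of_fixed hQ hQ' p) (le_of_fixed hQ' hQ p)

theorem stmt7 {S A : Type*} [Fintype S] [Fintype A] [Nonempty S] [Nonempty A]
    [DecidableEq S] [DecidableEq A]
    (P : S → A → S → ℝ) (R : S → A → ℝ) (γ : ℝ)
    (hP0 : ∀ s a s', 0 ≤ P s a s') (hP1 : ∀ s a, ∑ s' : S, P s a s' = 1)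
    (hγ0 : 0 ≤ γ) (hγ1 : γ < 1)
    (Q : S × A → ℝ) (β : S → A → ℝ)
    (hβ0 : ∀ s a, 0 ≤ β s a) (hβ1 : ∀ s, ∑ a : A, β s a = 1)
    (h : (γ • Matrix.of (fun p q : S × A => P p.1 p.2 q.1 * β q.1 q.2)
            - (1 : Matrix (S × A) (S × A) ℝ)).transpose.mulVec
          (fun p => bellT P R γ Q p - Q p) = 0) :
    bellT P R γ Q = Q ∧ ∀ Qstar : S × A → ℝ, bellT P R γ Qstar = Qstar → Q = Qstar := by
  have hfix : bellT P R γ Q = Q := by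
    refine sub_eq_zero.mp (eq_zero_of_discounted_vecMul_eq
      (N := fun p q : S × A => P p.1 p.2 q.1 * β q.1 q.2)
      (fun p q => mul_nonneg (hP0 _ _ _) (hβ0 _ _)) (fun p => ?_) hγ0 hγ1 fun q => ?_)
    · simp_rw [Fintype.sum_prod_type, ← Finset.mul_sum, hβ1, mul_one, hP1]
    · have hq := congrFun h q
      rw [Matrix.transpose_sub, Matrix.sub_mulVec, Matrix.transpose_one, Matrix.one_mulVec,
        Matrix.transpose_smul, Matrix.smul_mulVec] at hq
      exact sub_eq_zero.mp hq
  exact ⟨hfix, fun Qstar hQstar => bellT_fixedPoint_unique hP0 hP1 hγ0 hγ1 hfix hQstar⟩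
end

section
/- Suppose R_max ≥ 0 satisfies |R s a| ≤ R_max for all s, a, and let c ≥ 0. Then every Q : S × A → ℝ with (1/2)·‖T Q − Q‖₂² ≤ c satisfies ‖Q‖∞ ≤ (R_max + √(2c))/(1−γ). -/
theorem abs_le_l2Norm {S A : Type*} [Fintype S] [Fintype A] (Q : S × A → ℝ) (p : S × A) :
    |Q p| ≤ l2Norm Q :=
  Real.abs_le_sqrt
    (Finset.single_le_sum (f := fun p => Q p ^ 2) (fun _ _ => sq_nonneg _) (Finset.mem_univ p))

theorem abs_bellT_le {S A : Type*} [Fintype S] [Fintype A] [Nonempty S] [Nonempty A]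
    {P : S → A → S → ℝ} {R : S → A → ℝ} {γ : ℝ}
    (hP0 : ∀ s a s', 0 ≤ P s a s') (hP1 : ∀ s a, ∑ s' : S, P s a s' = 1) (hγ0 : 0 ≤ γ)
    {Rmax : ℝ} (hR : ∀ s a, |R s a| ≤ Rmax) (Q : S × A → ℝ) (p : S × A) :
    |bellT P R γ Q p| ≤ Rmax + γ * supNorm Q := by
  have hmax (s' : S) :
      |Finset.univ.sup' Finset.univ_nonempty fun a' : A => Q (s', a')| ≤ supNorm Q := by
    obtain ⟨a, -, ha⟩ := Finset.exists_mem_eq_sup' (Finset.univ_nonempty (α := A))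
      fun a' : A => Q (s', a')
    rw [ha]
    exact abs_le_supNorm Q (s', a)
  have hsum : |∑ s' : S, P p.1 p.2 s' *
      (Finset.univ.sup' Finset.univ_nonempty fun a' : A => Q (s', a'))| ≤ supNorm Q := by
    calc
      _ ≤ ∑ s' : S, |P p.1 p.2 s' *
          (Finset.univ.sup' Finset.univ_nonempty fun a' : A => Q (s', a'))| :=
        Finset.abs_sum_le_sum_abs _ _
      _ ≤ ∑ s' : S, P p.1 p.2 s' * supNorm Q := by
        refine Finset.sum_le_sum fun s' _ => ?_
        rw [abs_mul, abs_of_nonneg (hP0 _ _ _)]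
        exact mul_le_mul_of_nonneg_left (hmax s') (hP0 _ _ _)
      _ = supNorm Q := by rw [← Finset.sum_mul, hP1, one_mul]
  refine (abs_add_le _ _).trans (add_le_add (hR _ _) ?_)
  rw [abs_mul, abs_of_nonneg hγ0]
  exact mul_le_mul_of_nonneg_left hsum hγ0

theorem stmt9 {S A : Type*} [Fintype S] [Fintype A] [Nonempty S] [Nonempty A]
    (P : S → A → S → ℝ) (R : S → A → ℝ) (γ : ℝ)
    (hP0 : ∀ s a s', 0 ≤ P s a s') (hP1 : ∀ s a, ∑ s' : S, P s a s' = 1)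
    (hγ0 : 0 ≤ γ) (hγ1 : γ < 1)
    (Rmax : ℝ) (hRmax0 : 0 ≤ Rmax) (hR : ∀ s a, |R s a| ≤ Rmax)
    (c : ℝ) (hc : 0 ≤ c)
    (Q : S × A → ℝ)
    (hQ : (1 / 2) * (l2Norm (fun p => bellT P R γ Q p - Q p)) ^ 2 ≤ c) :
    supNorm Q ≤ (Rmax + Real.sqrt (2 * c)) / (1 - γ) := by
  have hres : l2Norm (fun p => bellT P R γ Q p - Q p) ≤ Real.sqrt (2 * c) :=
    Real.le_sqrt_of_sq_le (by linarith)
  obtain ⟨p, -, hp⟩ := Finset.exists_mem_eq_sup' (Finset.univ_nonempty (α := S × A))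
    fun p => |Q p|
  have hQp : supNorm Q = |Q p| := hp
  have hT := abs_bellT_le hP0 hP1 hγ0 hR Q p
  have hd := abs_le_l2Norm (fun p => bellT P R γ Q p - Q p) p
  have htri := abs_sub_abs_le_abs_sub (Q p) (bellT P R γ Q p)
  rw [abs_sub_comm] at htri
  rw [le_div_iff₀ (by linarith)]
  linarith
end

section
/- Fix λ > 0 and let Q : S × A → ℝ. If the vector (γ·M_{π_Q} − I)ᵀ·(F_λ Q − Q) is zero, where F_λ Q − Q is viewed as a vector indexed by S × A and π_Q is the Boltzmann policy of Q, then F_λ Q = Q; consequently, for every Q*_λ with F_λ Q*_λ = Q*_λ, one has Q = Q*_λ. -/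
/-- The soft control Bellman operator `F_λ`. -/
noncomputable def softT {S A : Type*} [Fintype S] [Fintype A]
    (P : S → A → S → ℝ) (R : S → A → ℝ) (γ lam : ℝ) (Q : S × A → ℝ) : S × A → ℝ :=
  fun p => R p.1 p.2 + γ * ∑ s' : S, P p.1 p.2 s' *
    (lam * Real.log (∑ a' : A, Real.exp (Q (s', a') / lam)))

/-- The Boltzmann policy of `Q` at temperature `lam`. -/
noncomputable def boltzmann {S A : Type*} [Fintype A]
    (lam : ℝ) (Q : S × A → ℝ) (s : S) (a : A) : ℝ :=
  Real.exp (Q (s, a) / lam) / ∑ u : A, Real.exp (Q (s, u) / lam)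

/-- An `ℓ¹`-contraction argument: a left fixed vector of `γ` times a row-stochastic matrix
with `γ < 1` vanishes. -/
theorem eq_zero_of_stochastic_left_fixed {ι : Type*} [Fintype ι] {M : ι → ι → ℝ} {γ : ℝ}
    (hM0 : ∀ p q, 0 ≤ M p q) (hM1 : ∀ p, ∑ q, M p q = 1) (hγ0 : 0 ≤ γ) (hγ1 : γ < 1)
    {v : ι → ℝ} (hv : ∀ q, v q = ∑ p, γ * M p q * v p) : v = 0 := by
  have hle : ∑ q, |v q| ≤ γ * ∑ p, |v p| := by
    calc ∑ q, |v q| ≤ ∑ q, ∑ p, γ * M p q * |v p| := by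
          refine Finset.sum_le_sum fun q _ => ?_
          conv_lhs => rw [hv q]
          refine (Finset.abs_sum_le_sum_abs _ _).trans_eq (Finset.sum_congr rfl fun p _ => ?_)
          rw [abs_mul, abs_of_nonneg (mul_nonneg hγ0 (hM0 p q))]
      _ = ∑ p, ∑ q, γ * M p q * |v p| := Finset.sum_comm
      _ = γ * ∑ p, |v p| := by
          rw [Finset.mul_sum]
          refine Finset.sum_congr rfl fun p _ => ?_
          rw [← Finset.sum_mul, ← Finset.mul_sum, hM1, mul_one]
  have h0 : 0 ≤ ∑ q, |v q| := Finset.sum_nonneg fun q _ => abs_nonneg _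
  have hs : ∑ q, |v q| = 0 := by nlinarith
  funext q
  exact abs_eq_zero.mp
    ((Finset.sum_eq_zero_iff_of_nonneg fun q _ => abs_nonneg (v q)).mp hs q (Finset.mem_univ q))

theorem mul_log_sum_exp_le_add {A : Type*} [Fintype A] [Nonempty A] {lam c : ℝ}
    (hlam : 0 < lam) {f g : A → ℝ} (hfg : ∀ a, f a ≤ g a + c) :
    lam * Real.log (∑ a, Real.exp (f a / lam)) ≤
      lam * Real.log (∑ a, Real.exp (g a / lam)) + c := by
  have hpos (k : A → ℝ) : 0 < ∑ a, Real.exp (k a / lam) :=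
    Finset.sum_pos (fun a _ => Real.exp_pos _) Finset.univ_nonempty
  have hsum : ∑ a, Real.exp (f a / lam) ≤ (∑ a, Real.exp (g a / lam)) * Real.exp (c / lam) := by
    rw [Finset.sum_mul]
    refine Finset.sum_le_sum fun a _ => ?_
    rw [← Real.exp_add, ← add_div]
    exact Real.exp_le_exp.mpr (div_le_div_of_nonneg_right (hfg a) hlam.le)
  have hlog := Real.log_le_log (hpos f) hsum
  rw [Real.log_mul (hpos g).ne' (Real.exp_pos _).ne', Real.log_exp] at hlog
  calc lam * Real.log (∑ a, Real.exp (f a / lam))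
      ≤ lam * (Real.log (∑ a, Real.exp (g a / lam)) + c / lam) :=
        mul_le_mul_of_nonneg_left hlog hlam.le
    _ = lam * Real.log (∑ a, Real.exp (g a / lam)) + c := by
        rw [mul_add, mul_div_cancel₀ _ hlam.ne']

theorem softT_le_add {S A : Type*} [Fintype S] [Fintype A] [Nonempty A]
    {P : S → A → S → ℝ} (R : S → A → ℝ) {γ lam c : ℝ}
    (hP0 : ∀ s a s', 0 ≤ P s a s') (hP1 : ∀ s a, ∑ s' : S, P s a s' = 1)
    (hγ0 : 0 ≤ γ) (hlam : 0 < lam) {Q Q' : S × A → ℝ} (hQ : ∀ p, Q p ≤ Q' p + c) (p : S × A) :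
    softT P R γ lam Q p ≤ softT P R γ lam Q' p + γ * c := by
  have hsum := Finset.sum_le_sum fun s' (_ : s' ∈ Finset.univ) =>
    mul_le_mul_of_nonneg_left
      (mul_log_sum_exp_le_add hlam fun a => hQ (s', a)) (hP0 p.1 p.2 s')
  simp only [mul_add, Finset.sum_add_distrib] at hsum
  rw [← Finset.sum_mul, hP1, one_mul] at hsum
  have hγ := mul_le_mul_of_nonneg_left hsum hγ0
  simp only [softT]
  linarith

theorem le_of_softT_fixed {S A : Type*} [Fintype S] [Fintype A] [Nonempty S] [Nonempty A]
    {P : S → A → S → ℝ} {R : S → A → ℝ} {γ lam : ℝ}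
    (hP0 : ∀ s a s', 0 ≤ P s a s') (hP1 : ∀ s a, ∑ s' : S, P s a s' = 1)
    (hγ0 : 0 ≤ γ) (hγ1 : γ < 1) (hlam : 0 < lam) {Q Q' : S × A → ℝ}
    (hQ : softT P R γ lam Q = Q) (hQ' : softT P R γ lam Q' = Q') : Q ≤ Q' := by
  obtain ⟨m, hm⟩ := Finite.exists_max fun p => Q p - Q' p
  have hle := softT_le_add R hP0 hP1 hγ0 hlam
    (fun p => sub_le_iff_le_add'.mp (hm p)) m
  rw [hQ, hQ'] at hle
  intro p
  have hp := hm p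
  nlinarith

theorem boltzmann_nonneg {S A : Type*} [Fintype A] (lam : ℝ) (Q : S × A → ℝ) (s : S) (a : A) :
    0 ≤ boltzmann lam Q s a := by
  unfold boltzmann
  positivity

theorem sum_boltzmann {S A : Type*} [Fintype A] [Nonempty A] (lam : ℝ) (Q : S × A → ℝ) (s : S) :
    ∑ a, boltzmann lam Q s a = 1 := by
  unfold boltzmann
  rw [← Finset.sum_div]
  exact div_self (Finset.sum_pos (fun a _ => Real.exp_pos _) Finset.univ_nonempty).ne'

theorem stmt16 {S A : Type*} [Fintype S] [Fintype A] [Nonempty S] [Nonempty A]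
    [DecidableEq S] [DecidableEq A]
    (P : S → A → S → ℝ) (R : S → A → ℝ) (γ : ℝ)
    (hP0 : ∀ s a s', 0 ≤ P s a s') (hP1 : ∀ s a, ∑ s' : S, P s a s' = 1)
    (hγ0 : 0 ≤ γ) (hγ1 : γ < 1)
    (lam : ℝ) (hlam : 0 < lam)
    (Q : S × A → ℝ)
    (h : (γ • Matrix.of (fun p q : S × A => P p.1 p.2 q.1 * boltzmann lam Q q.1 q.2)
            - (1 : Matrix (S × A) (S × A) ℝ)).transpose.mulVec
          (fun p => softT P R γ lam Q p - Q p) = 0) :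
    softT P R γ lam Q = Q
    ∧ ∀ Qs : S × A → ℝ, softT P R γ lam Qs = Qs → Q = Qs := by
  have hfix : softT P R γ lam Q = Q := by
    refine sub_eq_zero.mp (eq_zero_of_stochastic_left_fixed
      (M := fun p q : S × A => P p.1 p.2 q.1 * boltzmann lam Q q.1 q.2)
      (fun p q => mul_nonneg (hP0 _ _ _) (boltzmann_nonneg _ _ _ _)) (fun p => ?_)
      hγ0 hγ1 fun q => ?_)
    · simp only [Fintype.sum_prod_type, ← Finset.mul_sum, sum_boltzmann, mul_one, hP1]
    · have hq := congrFun h q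
      rw [Matrix.transpose_sub, Matrix.transpose_one, Matrix.sub_mulVec, Matrix.one_mulVec,
        Pi.sub_apply, Pi.zero_apply, sub_eq_zero] at hq
      exact hq.symm
  exact ⟨hfix, fun Qs hQs => le_antisymm
    (le_of_softT_fixed hP0 hP1 hγ0 hγ1 hlam hfix hQs)
    (le_of_softT_fixed hP0 hP1 hγ0 hγ1 hlam hQs hfix)⟩
end

section
/- Fix λ > 0 and define f : (S × A → ℝ) → ℝ by f(Q) = (1/2)·‖F_λ Q − Q‖₂², where the domain carries the Euclidean inner product. Then f is differentiable at every Q, and its gradient at Q is the vector g = (γ·M_{π_Q} − I)ᵀ·(F_λ Q − Q); that is, for every Q the Fréchet derivative of f at Q is the linear functional v ↦ ∑_{(s,a)} g(s,a)·v(s,a) with g(s,a) = ∑_{(s̄,ā)} (γ·M_{π_Q}((s̄,ā),(s,a)) − [(s̄,ā)=(s,a)])·((F_λ Q)(s̄,ā) − Q(s̄,ā)). -/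
/-- The gradient of the scaled log-sum-exp of `Q (s, ·)` is the Boltzmann policy at `s`. -/
theorem hasFDerivAt_logSumExp {S A : Type*} [Fintype S] [Fintype A] [Nonempty A]
    {lam : ℝ} (hlam : lam ≠ 0) (Q : S × A → ℝ) (s : S) :
    HasFDerivAt (fun Q' : S × A → ℝ => lam * Real.log (∑ a : A, Real.exp (Q' (s, a) / lam)))
      (∑ a : A, boltzmann lam Q s a •
        ContinuousLinearMap.proj (R := ℝ) (φ := fun _ : S × A => ℝ) (s, a)) Q := by
  have hpos : 0 < ∑ a : A, Real.exp (Q (s, a) / lam) :=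
    Finset.sum_pos (fun a _ => Real.exp_pos _) Finset.univ_nonempty
  have hexp (a : A) := ((hasFDerivAt_apply (𝕜 := ℝ) (s, a) Q).mul_const lam⁻¹).exp
  have hsum := HasFDerivAt.fun_sum (u := Finset.univ) fun a _ => hexp a
  simp only [← div_eq_mul_inv] at hsum
  refine ((hsum.log hpos.ne').const_mul lam).congr_fderiv ?_
  ext v
  simp only [boltzmann, smul_apply, sum_apply,
    ContinuousLinearMap.proj_apply, smul_eq_mul, Finset.mul_sum]
  refine Finset.sum_congr rfl fun a _ => ?_
  field_simp

/-- The derivative of `F_λ` is `γ • M`, with `M` the transition matrix of the Boltzmann policy. -/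
theorem hasFDerivAt_softT {S A : Type*} [Fintype S] [Fintype A] [Nonempty A]
    (P : S → A → S → ℝ) (R : S → A → ℝ) (γ : ℝ) {lam : ℝ} (hlam : lam ≠ 0)
    (Q : S × A → ℝ) (q : S × A) :
    HasFDerivAt (fun Q' => softT P R γ lam Q' q)
      (∑ p : S × A, (γ * (P q.1 q.2 p.1 * boltzmann lam Q p.1 p.2)) •
        ContinuousLinearMap.proj (R := ℝ) (φ := fun _ : S × A => ℝ) p) Q := by
  have hsum := HasFDerivAt.fun_sum (u := Finset.univ) fun s' _ =>
    (hasFDerivAt_logSumExp hlam Q s').const_mul (P q.1 q.2 s')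
  refine ((hsum.const_mul γ).const_add (R q.1 q.2)).congr_fderiv ?_
  simp only [Fintype.sum_prod_type, Finset.smul_sum, smul_smul]

theorem stmt17 {S A : Type*} [Fintype S] [Fintype A] [Nonempty S] [Nonempty A]
    [DecidableEq S] [DecidableEq A]
    (P : S → A → S → ℝ) (R : S → A → ℝ) (γ : ℝ)
    (hP0 : ∀ s a s', 0 ≤ P s a s') (hP1 : ∀ s a, ∑ s' : S, P s a s' = 1)
    (hγ0 : 0 ≤ γ) (hγ1 : γ < 1)
    (lam : ℝ) (hlam : 0 < lam) :
    ∀ Q : S × A → ℝ,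
      DifferentiableAt ℝ (fun Q' : S × A → ℝ =>
        (1 / 2) * (l2Norm (fun p => softT P R γ lam Q' p - Q' p)) ^ 2) Q
      ∧ ∀ v : S × A → ℝ,
          fderiv ℝ (fun Q' : S × A → ℝ =>
            (1 / 2) * (l2Norm (fun p => softT P R γ lam Q' p - Q' p)) ^ 2) Q v
          = ∑ p : S × A,
              (∑ q : S × A,
                (γ * (P q.1 q.2 p.1 * boltzmann lam Q p.1 p.2)
                    - (if q = p then (1 : ℝ) else 0))
                  * (softT P R γ lam Q q - Q q)) * v p := by
  intro Q
  have hres (q : S × A) :=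
    (((hasFDerivAt_softT P R γ hlam.ne' Q q).sub (hasFDerivAt_apply (𝕜 := ℝ) q Q)).pow 2)
  have hobj := (HasFDerivAt.fun_sum (u := Finset.univ) fun q _ => hres q).const_mul (1 / 2)
  simp only [l2Norm_sq]
  refine ⟨hobj.differentiableAt, fun v => ?_⟩
  refine (congrArg (fun L : (S × A → ℝ) →L[ℝ] ℝ => L v) hobj.fderiv).trans ?_
  simp only [Finset.sum_mul]
  rw [Finset.sum_comm]
  simp only [smul_apply, sum_apply,
    sub_apply, ContinuousLinearMap.proj_apply, smul_eq_mul, Finset.mul_sum,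
    Pi.sub_apply]
  refine Finset.sum_congr rfl fun q _ => ?_
  have hv : v q = ∑ p : S × A, (if q = p then (1 : ℝ) else 0) * v p := by simp
  rw [hv, ← Finset.sum_sub_distrib, Finset.mul_sum, Finset.mul_sum]
  refine Finset.sum_congr rfl fun p _ => ?_
  simp only [nsmul_eq_mul]
  push_cast
  ring
end
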